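/- Let (m_k), (n_k) be sequences of integers and (q_k) a sequence of reals with 1 ≤ n_k ≤ m_k and q_k ∈ (0,1) for all k. If (m_k − n_k + 1)·log(1/q_k) − log m_k → ∞ as k → ∞, then the total variation distance (1/2) Σ_B |π_{m_k,n_k,q_k}(B) − π_{∞,n_k,q_k}(B)| → 0 as k → ∞, where for each k the sum ranges over all finite n_k-element subsets B ⊆ ℕ. -/

import Mathlib

noncomputable section

/-- The `q`-analogue `[k]_q = (1 - q^k)/(1 - q)` of a natural number `k`. -/
def qAnalogue (q : ℝ) (k : ℕ) : ℝ := (1 - q ^ k) / (1 - q)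

/-- The `q`-Stirling numbers of the second kind `S_q[a,b]`. -/
def qStirling (q : ℝ) : ℕ → ℕ → ℝ
  | 0, 0 => 1
  | 0, _ + 1 => 0
  | _ + 1, 0 => 0
  | a + 1, b + 1 => q ^ b * qStirling q a b + qAnalogue q (b + 1) * qStirling q a (b + 1)

/-- The normalization constant `Z(m,n,q) = q^(C(m+1,2) - n) * S_{1/q}[m+1, m-n+1]`. -/
def Zval (m n : ℕ) (q : ℝ) : ℝ :=
  q ^ (((m + 1).choose 2 : ℤ) - (n : ℤ)) * qStirling (1 / q) (m + 1) (m - n + 1)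

/-- `v_B(x) = |{x, x+1, ..., m-1} \ B|`. -/
def vB (m : ℕ) (B : Finset ℕ) (x : ℕ) : ℕ := ((Finset.Ico x m) \ B).card

/-- The stationary weight `W_{m,q}(B) = ∏_{x ∈ B} [1 + v_B(x)]_q * q^x`. -/
def W (m : ℕ) (q : ℝ) (B : Finset ℕ) : ℝ :=
  ∏ x ∈ B, qAnalogue q (1 + vB m B x) * q ^ x

/-- The stationary distribution of the bounded geometric JEP. -/
def piBdd (m n : ℕ) (q : ℝ) (B : Finset ℕ) : ℝ :=
  if B ⊆ Finset.range m then W m q B / Zval m n q else 0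

/-- The stationary distribution of the unbounded geometric JEP. -/
def piUnbdd (n : ℕ) (q : ℝ) (B : Finset ℕ) : ℝ :=
  (∏ k ∈ Finset.Icc 1 n, (1 - q ^ k)) * q ^ (-(n.choose 2 : ℤ)) * ∏ x ∈ B, q ^ x

open Finset

/-- shift embedding -/
abbrev sE : ℕ ↪ ℕ := ⟨Nat.succ, Nat.succ_injective⟩

lemma range_succ_shift (m : ℕ) : range (m + 1) = insert 0 ((range m).map sE) := by
  ext x
  simp only [mem_range, mem_insert, mem_map, Function.Embedding.coeFn_mk]
  constructor
  · intro h
    rcases x with _ | x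
    · simp
    · exact Or.inr ⟨x, by omega, rfl⟩
  · rintro (h | ⟨a, h, rfl⟩) <;> omega

lemma zero_notMem_shift (B : Finset ℕ) : 0 ∉ B.map sE := by simp

lemma sum_shift (f : Finset ℕ → ℝ) (m n : ℕ) :
    ∑ B ∈ powersetCard (n + 1) (range (m + 1)), f B =
      ∑ B ∈ powersetCard (n + 1) (range m), f (B.map sE) +
      ∑ B ∈ powersetCard n (range m), f (insert 0 (B.map sE)) := by
  rw [range_succ_shift, powersetCard_succ_insert (zero_notMem_shift _), sum_union, sum_image,
    powersetCard_map, powersetCard_map, sum_map, sum_map]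
  · rfl
  · intro A hA B hB h
    have hA' : 0 ∉ A := fun h0 => zero_notMem_shift _ ((mem_powersetCard.1 hA).1 h0)
    have hB' : 0 ∉ B := fun h0 => zero_notMem_shift _ ((mem_powersetCard.1 hB).1 h0)
    rw [← erase_insert hA', ← erase_insert hB']
    exact congrArg (fun s => s.erase 0) h
  · rw [disjoint_left]
    intro A hA hB
    obtain ⟨C, _, rfl⟩ := mem_image.1 hB
    exact zero_notMem_shift _ ((mem_powersetCard.1 hA).1 (mem_insert_self 0 C))

lemma vB_shift (m : ℕ) (B : Finset ℕ) (x : ℕ) : vB (m + 1) (B.map sE) (x + 1) = vB m B x := by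
  unfold vB
  have : Ico (x + 1) (m + 1) \ B.map sE = (Ico x m \ B).map sE := by
    ext y
    rcases y with _ | y <;> simp
  rw [this, card_map]

lemma vB_shift_insert (m : ℕ) (B : Finset ℕ) (x : ℕ) :
    vB (m + 1) (insert 0 (B.map sE)) (x + 1) = vB m B x := by
  rw [← vB_shift m B x]
  unfold vB
  congr 1
  ext y
  rcases y with _ | y <;> simp

lemma vB_zero (m n : ℕ) (B : Finset ℕ) (hB : B ∈ powersetCard n (range m)) :
    vB (m + 1) (insert 0 (B.map sE)) 0 = m - n := by
  obtain ⟨h1, h2⟩ := mem_powersetCard.1 hB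
  unfold vB
  have hs : insert 0 (B.map sE) ⊆ Ico 0 (m + 1) := by
    rw [← range_eq_Ico, range_succ_shift]
    exact insert_subset_insert _ (map_subset_map.2 h1)
  rw [card_sdiff_of_subset hs, card_insert_of_notMem (zero_notMem_shift _), card_map, h2]
  simp

lemma W_shift (m n : ℕ) (q : ℝ) (B : Finset ℕ) (hB : B.card = n) :
    W (m + 1) q (B.map sE) = q ^ n * W m q B := by
  unfold W
  rw [prod_map, ← hB, ← prod_const, ← prod_mul_distrib]
  refine prod_congr rfl fun x _ => ?_
  have := vB_shift m B x
  simp only [Function.Embedding.coeFn_mk, Nat.succ_eq_add_one, this, pow_succ]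
  ring

lemma W_shift_insert (m n : ℕ) (q : ℝ) (B : Finset ℕ) (hB : B ∈ powersetCard n (range m)) :
    W (m + 1) q (insert 0 (B.map sE)) = q ^ n * qAnalogue q (m - n + 1) * W m q B := by
  have h2 := (mem_powersetCard.1 hB).2
  unfold W
  rw [prod_insert (zero_notMem_shift _), prod_map, vB_zero m n B hB]
  have : ∏ x ∈ B, qAnalogue q (1 + vB (m + 1) (insert 0 (B.map sE)) (sE x)) * q ^ (sE x)
      = q ^ n * ∏ x ∈ B, qAnalogue q (1 + vB m B x) * q ^ x := by
    rw [← h2, ← prod_const, ← prod_mul_distrib]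
    refine prod_congr rfl fun x _ => ?_
    have := vB_shift_insert m B x
    simp only [Function.Embedding.coeFn_mk, Nat.succ_eq_add_one, this, pow_succ]
    ring
  rw [this, add_comm 1]
  ring

/-- sum of the weights -/
def Zs (q : ℝ) (m n : ℕ) : ℝ := ∑ B ∈ powersetCard n (range m), W m q B

lemma Zs_rec (q : ℝ) (m n : ℕ) : Zs q (m + 1) (n + 1) =
    q ^ (n + 1) * Zs q m (n + 1) + q ^ n * qAnalogue q (m - n + 1) * Zs q m n := by
  unfold Zs
  rw [sum_shift, mul_sum, mul_sum]
  congr 1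
  · exact sum_congr rfl fun B hB => W_shift _ _ _ _ (mem_powersetCard.1 hB).2
  · exact sum_congr rfl fun B hB => W_shift_insert _ _ _ _ hB

lemma Zs_zero (q : ℝ) (m : ℕ) : Zs q m 0 = 1 := by simp [Zs, W]

lemma Zs_gt (q : ℝ) (m n : ℕ) (h : m < n) : Zs q m n = 0 := by
  unfold Zs
  rw [powersetCard_eq_empty.2 (by simpa using h), sum_empty]

lemma qS_gt (p : ℝ) (a : ℕ) : ∀ b, a < b → qStirling p a b = 0 := by
  induction a with
  | zero => intro b hb; obtain ⟨c, rfl⟩ : ∃ c, b = c + 1 := ⟨b - 1, by omega⟩; simp [qStirling]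
  | succ a ih =>
    intro b hb
    obtain ⟨c, rfl⟩ : ∃ c, b = c + 1 := ⟨b - 1, by omega⟩
    simp [qStirling, ih c (by omega), ih (c + 1) (by omega)]

lemma qS_diag (p : ℝ) (a : ℕ) : qStirling p a a = p ^ (a.choose 2) := by
  induction a with
  | zero => simp [qStirling]
  | succ a ih =>
    have : (a + 1).choose 2 = a + a.choose 2 := by
      rw [Nat.choose_succ_succ' a 1, Nat.choose_one_right]
    rw [qStirling, ih, qS_gt p a (a + 1) (by omega), this, pow_add]
    ring

lemma qA_inv (q : ℝ) (h0 : 0 < q) (h1 : q < 1) (d : ℕ) :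
    q ^ d * qAnalogue (1 / q) (d + 1) = qAnalogue q (d + 1) := by
  unfold qAnalogue
  have : q ≠ 0 := h0.ne'
  have h2 : 1 - q ≠ 0 := by linarith
  have h3 : q - 1 ≠ 0 := by linarith
  have h4 : 1 - 1 / q ≠ 0 := by
    rw [one_sub_div this]; exact div_ne_zero h3 this
  rw [one_div, inv_pow] at *
  rw [← mul_div_assoc, div_eq_div_iff h4 h2]
  field_simp
  ring

lemma Zval_eq (q : ℝ) (h0 : 0 < q) (h1 : q < 1) (m : ℕ) : ∀ n, n ≤ m →
    Zval m n q = Zs q m n := by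
  have hq : q ≠ 0 := h0.ne'
  have hzero : ∀ m, Zval m 0 q = 1 := by
    intro m
    unfold Zval
    rw [Nat.sub_zero, qS_diag]
    simp only [Nat.cast_zero, sub_zero, zpow_natCast, ← mul_pow]
    rw [mul_one_div_cancel hq, one_pow]
  induction m with
  | zero =>
    intro n hn
    obtain rfl : n = 0 := by omega
    rw [hzero, Zs_zero]
  | succ m ih =>
    intro n hn
    rcases n with _ | n
    · rw [hzero, Zs_zero]
    obtain ⟨d, rfl⟩ : ∃ d, m = n + d := ⟨m - n, by omega⟩
    have hch : (((n + d + 1 + 1).choose 2 : ℕ) : ℤ) = ((n + d + 1).choose 2 : ℕ) + n + d + 1 := by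
      rw [Nat.choose_succ_succ' (n + d + 1) 1, Nat.choose_one_right]; push_cast; ring
    rw [Zs_rec, ← ih n (by omega)]
    have e1 : n + d + 1 - (n + 1) + 1 = d + 1 := by omega
    have e2 : n + d - n + 1 = d + 1 := by omega
    rw [Zval, e1, qStirling, Zval, e2, ← qA_inv q h0 h1 d]
    have hfirst : q ^ (n + 1) * Zs q (n + d) (n + 1) =
        q ^ ((n + d + 1).choose 2) * qStirling (1 / q) (n + d + 1) d := by
      rcases d with _ | d
      · rw [Zs_gt _ _ _ (by omega)]; simp [qStirling]
      · rw [← ih (n + 1) (by omega), Zval]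
        have e3 : n + (d + 1) - (n + 1) + 1 = d + 1 := by omega
        rw [e3, ← mul_assoc, ← zpow_natCast, ← zpow_add₀ hq, ← zpow_natCast]
        congr 2
        ring
    rw [hfirst, hch]
    have e4 : q ^ ((((n + d + 1).choose 2 : ℕ) : ℤ) + n + d + 1 - ((n + 1 : ℕ) : ℤ))
        = q ^ ((n + d + 1).choose 2) * q ^ d := by
      rw [← zpow_natCast, ← zpow_natCast, ← zpow_add₀ hq]; congr 1; push_cast; ring
    have e5 : q ^ n * q ^ ((((n + d + 1).choose 2 : ℕ) : ℤ) - (n : ℤ))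
        = q ^ ((n + d + 1).choose 2) := by
      rw [← zpow_natCast, ← zpow_natCast, ← zpow_add₀ hq]; congr 1; ring
    have e6 : q ^ d * (1 / q) ^ d = 1 := by
      rw [← mul_pow, mul_one_div_cancel hq, one_pow]
    rw [e4]
    linear_combination (q ^ ((n + d + 1).choose 2) * qStirling (1 / q) (n + d + 1) d) * e6
      - (q ^ d * qAnalogue (1 / q) (d + 1) * qStirling (1 / q) (n + d + 1) (d + 1)) * e5

/-- prefactor of the unbounded distribution -/
def Kc (q : ℝ) (n : ℕ) : ℝ := (∏ k ∈ Icc 1 n, (1 - q ^ k)) * q ^ (-(n.choose 2 : ℤ))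

lemma Kc_zero (q : ℝ) : Kc q 0 = 1 := by simp [Kc]

lemma Kc_succ (q : ℝ) (h0 : 0 < q) (n : ℕ) :
    Kc q (n + 1) * q ^ n = Kc q n * (1 - q ^ (n + 1)) := by
  unfold Kc
  have hq : q ≠ 0 := h0.ne'
  rw [prod_Icc_succ_top (by omega)]
  have : q ^ (-((n + 1).choose 2 : ℤ)) * q ^ n = q ^ (-(n.choose 2 : ℤ)) := by
    rw [Nat.choose_succ_succ' n 1, Nat.choose_one_right, ← zpow_natCast, ← zpow_add₀ hq]
    congr 1; push_cast; ring
  rw [← this]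
  ring

lemma Kc_pos (q : ℝ) (h0 : 0 < q) (h1 : q < 1) (n : ℕ) : 0 < Kc q n := by
  unfold Kc
  refine mul_pos (prod_pos fun k hk => ?_) (zpow_pos h0 _)
  have := pow_lt_one₀ h0.le h1 (n := k) (by have := (mem_Icc.1 hk).1; omega)
  linarith

lemma sumU_le (q : ℝ) (h0 : 0 < q) (h1 : q < 1) (M : ℕ) : ∀ n,
    Kc q n * ∑ B ∈ powersetCard n (range M), ∏ x ∈ B, q ^ x ≤ 1 := by
  induction M with
  | zero =>
    intro n
    rcases n with _ | n
    · simp [Kc_zero]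
    · rw [powersetCard_eq_empty.2 (by simp)]; simp
  | succ M ih =>
    intro n
    rcases n with _ | n
    · simp [Kc_zero]
    rw [sum_shift]
    have key : ∀ n, ∀ B ∈ powersetCard n (range M),
        ∏ x ∈ B.map sE, q ^ x = q ^ n * ∏ x ∈ B, q ^ x := by
      intro n B hB
      rw [prod_map, ← (mem_powersetCard.1 hB).2, ← prod_const, ← prod_mul_distrib]
      refine prod_congr rfl fun x _ => ?_
      simp only [Function.Embedding.coeFn_mk, Nat.succ_eq_add_one, pow_succ]
      ring
    rw [sum_congr rfl (key (n + 1)), ← mul_sum]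
    have : ∑ B ∈ powersetCard n (range M), ∏ x ∈ insert 0 (B.map sE), q ^ x =
        q ^ n * ∑ B ∈ powersetCard n (range M), ∏ x ∈ B, q ^ x := by
      rw [mul_sum]
      refine sum_congr rfl fun B hB => ?_
      rw [prod_insert (zero_notMem_shift _), key n B hB]; simp
    rw [this, mul_add, ← mul_assoc _ (q ^ n), Kc_succ q h0]
    have a1 := ih (n + 1)
    have a2 := ih n
    have p1 : 0 ≤ q ^ (n + 1) := by positivity
    have p2 : q ^ (n + 1) ≤ 1 := pow_le_one₀ h0.le h1.le
    nlinarith [mul_le_mul_of_nonneg_left a1 p1, mul_le_mul_of_nonneg_left a2 (sub_nonneg.2 p2)]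

/-- ratio of the normalizations -/
def Rr (q : ℝ) (m n : ℕ) : ℝ := Zs q m n * (1 - q) ^ n * Kc q n

lemma Rr_rec (q : ℝ) (h0 : 0 < q) (h1 : q < 1) (m n : ℕ) : Rr q (m + 1) (n + 1) =
    q ^ (n + 1) * Rr q m (n + 1) + (1 - q ^ (n + 1)) * (1 - q ^ (m - n + 1)) * Rr q m n := by
  unfold Rr
  rw [Zs_rec]
  have h2 : (1 - q) * qAnalogue q (m - n + 1) = 1 - q ^ (m - n + 1) := by
    unfold qAnalogue
    exact mul_div_cancel₀ _ (by linarith)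
  rw [← h2]
  linear_combination (qAnalogue q (m - n + 1) * Zs q m n * (1 - q) ^ (n + 1)) * Kc_succ q h0 n

lemma Rr_zero (q : ℝ) (m : ℕ) : Rr q m 0 = 1 := by simp [Rr, Zs_zero, Kc_zero]

lemma Rr_gt (q : ℝ) (m n : ℕ) (h : m < n) : Rr q m n = 0 := by simp [Rr, Zs_gt q m n h]

lemma Rr_mem (q : ℝ) (h0 : 0 < q) (h1 : q < 1) (m : ℕ) : ∀ n, 0 ≤ Rr q m n ∧ Rr q m n ≤ 1 := by
  induction m with
  | zero =>
    intro n
    rcases n with _ | n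
    · simp [Rr_zero]
    · simp [Rr_gt]
  | succ m ih =>
    intro n
    rcases n with _ | n
    · simp [Rr_zero]
    rw [Rr_rec q h0 h1]
    obtain ⟨a1, a2⟩ := ih (n + 1)
    obtain ⟨b1, b2⟩ := ih n
    have p1 : 0 ≤ q ^ (n + 1) := by positivity
    have p2 : 0 ≤ 1 - q ^ (n + 1) := sub_nonneg.2 (pow_le_one₀ h0.le h1.le)
    have p3 : 0 ≤ q ^ (m - n + 1) := by positivity
    have p4 : 0 ≤ 1 - q ^ (m - n + 1) := sub_nonneg.2 (pow_le_one₀ h0.le h1.le)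
    refine ⟨by positivity, ?_⟩
    have c : (1 - q ^ (m - n + 1)) * Rr q m n ≤ 1 := by nlinarith
    nlinarith [mul_le_mul_of_nonneg_left c p2, mul_le_mul_of_nonneg_left a2 p1]

lemma qA_ge_one (q : ℝ) (h0 : 0 < q) (h1 : q < 1) (n : ℕ) : 1 ≤ qAnalogue q (n + 1) := by
  unfold qAnalogue
  rw [le_div_iff₀ (by linarith), pow_succ]
  nlinarith [pow_le_one₀ h0.le h1.le (n := n)]

lemma Rr_lower (q : ℝ) (h0 : 0 < q) (h1 : q < 1) (m : ℕ) : ∀ n, n ≤ m + 1 →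
    1 - Rr q m n ≤ (qAnalogue q n + m * (1 - q ^ n)) * q ^ (m + 1 - n) := by
  have triv : ∀ m n, m < n → n ≤ m + 1 →
      1 - Rr q m n ≤ (qAnalogue q n + m * (1 - q ^ n)) * q ^ (m + 1 - n) := by
    intro m n h h'
    obtain rfl : n = m + 1 := by omega
    rw [Rr_gt _ _ _ h, Nat.sub_self]
    have p2 : 0 ≤ 1 - q ^ (m + 1) := sub_nonneg.2 (pow_le_one₀ h0.le h1.le)
    have := qA_ge_one q h0 h1 m
    have : 0 ≤ (m : ℝ) * (1 - q ^ (m + 1)) := by positivity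
    linarith
  have hz : ∀ m, 1 - Rr q m 0 ≤ (qAnalogue q 0 + m * (1 - q ^ 0)) * q ^ (m + 1 - 0) := by
    intro m; simp [Rr_zero, qAnalogue]
  induction m with
  | zero =>
    intro n hn
    rcases n with _ | n
    · exact hz 0
    · exact triv _ _ (by omega) hn
  | succ m ih =>
    intro n hn
    rcases n with _ | n
    · exact hz _
    rcases Nat.lt_or_ge (m + 1) (n + 1) with h | h
    · exact triv _ _ h hn
    obtain ⟨d, rfl⟩ : ∃ d, m = n + d := ⟨m - n, by omega⟩
    have i1 := ih (n + 1) (by omega)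
    have i2 := ih n (by omega)
    rw [Rr_rec q h0 h1]
    have e1 : n + d + 1 - (n + 1) = d := by omega
    have e2 : n + d + 1 - n = d + 1 := by omega
    have e3 : n + d - n + 1 = d + 1 := by omega
    have e4 : n + d + 1 + 1 - (n + 1) = d + 1 := by omega
    rw [e1] at i1
    rw [e2] at i2
    rw [e3, e4]
    have hb := (Rr_mem q h0 h1 (n + d) n).2
    have p1 : 0 ≤ q ^ (n + 1) := by positivity
    have p2 : 0 ≤ 1 - q ^ (n + 1) := sub_nonneg.2 (pow_le_one₀ h0.le h1.le)
    have p3 : 0 ≤ q ^ (d + 1) := by positivity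
    have j1 := mul_le_mul_of_nonneg_left i1 p1
    have j2 := mul_le_mul_of_nonneg_left i2 p2
    have j3 := mul_le_mul_of_nonneg_left hb (mul_nonneg p2 p3)
    have hA : (1 - q ^ n) * qAnalogue q (n + 1) = (1 - q ^ (n + 1)) * qAnalogue q n := by
      unfold qAnalogue; ring
    have hfin : q ^ (n + 1) * ((qAnalogue q (n + 1) + ((n + d : ℕ) : ℝ) * (1 - q ^ (n + 1))) * q ^ d)
        + (1 - q ^ (n + 1)) * ((qAnalogue q n + ((n + d : ℕ) : ℝ) * (1 - q ^ n)) * q ^ (d + 1))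
        + (1 - q ^ (n + 1)) * q ^ (d + 1) * 1
        = (qAnalogue q (n + 1) + ((n + d + 1 : ℕ) : ℝ) * (1 - q ^ (n + 1))) * q ^ (d + 1) := by
      push_cast
      linear_combination (-q ^ (d + 1)) * hA
    linarith

lemma Rr_lower' (q : ℝ) (h0 : 0 < q) (h1 : q < 1) (m n : ℕ) (hn : n ≤ m) :
    1 - Rr q m n ≤ 2 * (m * q ^ (m - n + 1)) := by
  have h := Rr_lower q h0 h1 m n (by omega)
  have e : m + 1 - n = m - n + 1 := by omega
  rw [e] at h
  have hA : qAnalogue q n ≤ n := by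
    unfold qAnalogue
    rw [div_le_iff₀ (by linarith)]
    have := one_add_mul_le_pow (a := q - 1) (by linarith) n
    have e : 1 + (q - 1) = q := by ring
    rw [e] at this
    linarith
  have hn' : (n : ℝ) ≤ m := by exact_mod_cast hn
  have p : 0 ≤ q ^ n := by positivity
  have p2 : 0 ≤ (m : ℝ) * q ^ n := by positivity
  have p3 : 0 ≤ q ^ (m - n + 1) := by positivity
  have : qAnalogue q n + m * (1 - q ^ n) ≤ 2 * m := by linarith
  have := mul_le_mul_of_nonneg_right this p3
  linarith

lemma W_nonneg (m : ℕ) (q : ℝ) (h0 : 0 < q) (h1 : q < 1) (B : Finset ℕ) : 0 ≤ W m q B := by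
  unfold W
  refine prod_nonneg fun x _ => mul_nonneg ?_ (by positivity)
  have := qA_ge_one q h0 h1 (vB m B x)
  rw [add_comm]; linarith

lemma W_le (m : ℕ) (q : ℝ) (h0 : 0 < q) (h1 : q < 1) (B : Finset ℕ) :
    W m q B * (1 - q) ^ B.card ≤ ∏ x ∈ B, q ^ x := by
  unfold W
  rw [← prod_const, ← prod_mul_distrib]
  have hA : ∀ k, qAnalogue q k * (1 - q) = 1 - q ^ k := fun k => by
    unfold qAnalogue
    exact div_mul_cancel₀ _ (by linarith)
  have hk : ∀ k, 0 ≤ 1 - q ^ k := fun k => sub_nonneg.2 (pow_le_one₀ h0.le h1.le)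
  refine prod_le_prod (fun x _ => ?_) (fun x _ => ?_)
  · rw [mul_right_comm, hA]
    exact mul_nonneg (hk _) (by positivity)
  · rw [mul_right_comm, hA]
    have : 0 ≤ q ^ (1 + vB m B x) := by positivity
    have : 0 ≤ q ^ x := by positivity
    nlinarith

lemma Zs_pos (q : ℝ) (h0 : 0 < q) (h1 : q < 1) (m n : ℕ) (hn : n ≤ m) : 0 < Zs q m n := by
  unfold Zs
  refine sum_pos (fun B _ => ?_) (powersetCard_nonempty.2 (by simpa using hn))
  unfold W
  refine prod_pos fun x _ => mul_pos ?_ (by positivity)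
  have := qA_ge_one q h0 h1 (vB m B x)
  rw [add_comm]; linarith

lemma piBdd_nonneg (q : ℝ) (h0 : 0 < q) (h1 : q < 1) (m n : ℕ) (hn : n ≤ m) (B : Finset ℕ) :
    0 ≤ piBdd m n q B := by
  unfold piBdd
  split_ifs
  · rw [Zval_eq q h0 h1 m n hn]
    exact div_nonneg (W_nonneg m q h0 h1 B) (Zs_pos q h0 h1 m n hn).le
  · exact le_rfl

lemma piBdd_mul_le (q : ℝ) (h0 : 0 < q) (h1 : q < 1) (m n : ℕ) (hn : n ≤ m) (B : Finset ℕ)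
    (hB : B.card = n) : piBdd m n q B * Rr q m n ≤ piUnbdd n q B := by
  have hK := Kc_pos q h0 h1 n
  have hU : piUnbdd n q B = Kc q n * ∏ x ∈ B, q ^ x := rfl
  rw [hU]
  unfold piBdd
  split_ifs
  · rw [Zval_eq q h0 h1 m n hn]
    have hz := (Zs_pos q h0 h1 m n hn).ne'
    have e : W m q B / Zs q m n * Rr q m n = Kc q n * (W m q B * (1 - q) ^ B.card) := by
      unfold Rr; rw [hB]; field_simp
    rw [e]
    exact mul_le_mul_of_nonneg_left (W_le m q h0 h1 B) hK.le
  · rw [zero_mul]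
    exact mul_nonneg hK.le (prod_nonneg fun x _ => by positivity)

lemma sum_piBdd (q : ℝ) (h0 : 0 < q) (h1 : q < 1) (m n M : ℕ) (hn : n ≤ m) (hM : m ≤ M) :
    ∑ B ∈ powersetCard n (range M), piBdd m n q B = 1 := by
  have hsub : powersetCard n (range m) ⊆ powersetCard n (range M) :=
    powersetCard_mono (range_subset_range.2 hM)
  rw [← sum_subset hsub]
  · have : ∀ B ∈ powersetCard n (range m), piBdd m n q B = W m q B / Zs q m n := by
      intro B hB
      unfold piBdd
      rw [if_pos (mem_powersetCard.1 hB).1, Zval_eq q h0 h1 m n hn]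
    rw [sum_congr rfl this, ← sum_div]
    exact div_self (Zs_pos q h0 h1 m n hn).ne'
  · intro B hB hB'
    unfold piBdd
    rw [if_neg]
    exact fun h => hB' (mem_powersetCard.2 ⟨h, (mem_powersetCard.1 hB).2⟩)

lemma tv_bound (q : ℝ) (h0 : 0 < q) (h1 : q < 1) (m n : ℕ) (hn : n ≤ m) :
    (1 / 2) * ∑' B : {B : Finset ℕ // B.card = n}, |piBdd m n q B.val - piUnbdd n q B.val|
      ≤ 2 * (m * q ^ (m - n + 1)) := by
  have hR := Rr_mem q h0 h1 m n
  refine le_trans ?_ (Rr_lower' q h0 h1 m n hn)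
  have : ∑' B : {B : Finset ℕ // B.card = n}, |piBdd m n q B.val - piUnbdd n q B.val|
      ≤ 2 * (1 - Rr q m n) := by
    refine Real.tsum_le_of_sum_le (fun _ => abs_nonneg _) fun s => ?_
    obtain ⟨M, hmM, hM⟩ : ∃ M, m ≤ M ∧ ∀ B ∈ s, B.val ⊆ range M := by
      obtain ⟨N, hN⟩ := (s.biUnion fun B => B.val).exists_nat_subset_range
      refine ⟨max m N, le_max_left _ _, fun B hB => ?_⟩
      exact ((subset_biUnion_of_mem (fun B : {B : Finset ℕ // B.card = n} => B.val) hB).trans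
        hN).trans (range_subset_range.2 (le_max_right _ _))
    have hs : s.map (Function.Embedding.subtype _) ⊆ powersetCard n (range M) := by
      intro B hB
      obtain ⟨C, hC, rfl⟩ := mem_map.1 hB
      exact mem_powersetCard.2 ⟨hM C hC, C.2⟩
    calc ∑ B ∈ s, |piBdd m n q B.val - piUnbdd n q B.val|
        = ∑ B ∈ s.map (Function.Embedding.subtype _), |piBdd m n q B - piUnbdd n q B| := by
          rw [sum_map]; rfl
      _ ≤ ∑ B ∈ powersetCard n (range M), |piBdd m n q B - piUnbdd n q B| :=
          sum_le_sum_of_subset_of_nonneg hs fun _ _ _ => abs_nonneg _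
      _ ≤ ∑ B ∈ powersetCard n (range M),
            (piBdd m n q B * (1 - 2 * Rr q m n) + piUnbdd n q B) := by
          refine sum_le_sum fun B hB => ?_
          have a := piBdd_nonneg q h0 h1 m n hn B
          have b := piBdd_mul_le q h0 h1 m n hn B (mem_powersetCard.1 hB).2
          have c := mul_le_mul_of_nonneg_left hR.2 a
          rw [abs_le]
          constructor <;> nlinarith
      _ ≤ 2 * (1 - Rr q m n) := by
          rw [sum_add_distrib, ← sum_mul, sum_piBdd q h0 h1 m n M hn hmM]
          have : ∑ B ∈ powersetCard n (range M), piUnbdd n q B ≤ 1 := by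
            have h := sumU_le q h0 h1 M n
            rw [mul_sum] at h
            exact h
          linarith
  linarith

/-- If `(m_k - n_k + 1) log(1/q_k) - log m_k → ∞`, then the total variation distance
between the stationary distributions of the bounded and unbounded geometric juggler's
exclusion processes tends to `0`. -/
theorem tv_tendsto_zero (m n : ℕ → ℕ) (q : ℕ → ℝ)
    (hn : ∀ k, 1 ≤ n k) (hm : ∀ k, n k ≤ m k) (hq : ∀ k, q k ∈ Set.Ioo (0 : ℝ) 1)
    (hgrowth : Filter.Tendsto
      (fun k => ((m k - n k + 1 : ℕ) : ℝ) * Real.log (1 / q k) - Real.log (m k))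
      Filter.atTop Filter.atTop) :
    Filter.Tendsto
      (fun k => (1 / 2) * ∑' B : {B : Finset ℕ // B.card = n k},
        |piBdd (m k) (n k) (q k) B.val - piUnbdd (n k) (q k) B.val|)
      Filter.atTop (nhds 0) := by
  refine squeeze_zero (fun k => ?_)
    (fun k => tv_bound (q k) (hq k).1 (hq k).2 (m k) (n k) (hm k)) ?_
  · exact mul_nonneg (by norm_num) (tsum_nonneg fun _ => abs_nonneg _)
  · have h1 := (Real.tendsto_exp_neg_atTop_nhds_zero.comp hgrowth).const_mul 2
    rw [mul_zero] at h1
    refine h1.congr fun k => ?_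
    have hmpos : (0 : ℝ) < m k := by exact_mod_cast lt_of_lt_of_le (hn k) (hm k)
    simp only [Function.comp]
    congr 1
    rw [neg_sub, Real.exp_sub, Real.exp_log hmpos, Real.exp_nat_mul,
      Real.exp_log (one_div_pos.2 (hq k).1), one_div, inv_pow, div_inv_eq_mul]
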